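/- arXiv:2007.07481 — 4 statements merged into one kernel-verified Lean document; each statement's English description precedes it below -/
import Mathlib

section
/- Consider m clients with local objectives F_i(x) = (1/2)‖x − e_i‖² on ℝ^d, where e_1, …, e_m ∈ ℝ^d. Run FedAvg with full participation and exact gradients: in each round t, every client i starts from the global model x^{(t,0)} and performs τ_i ≥ 1 gradient-descent steps x_i^{(t,k+1)} = x_i^{(t,k)} − η(x_i^{(t,k)} − e_i) with x_i^{(t,0)} = x^{(t,0)}, and the server sets x^{(t+1,0)} = x^{(t,0)} + (1/m) Σ_{i=1}^m (x_i^{(t,τ_i)} − x^{(t,0)}). Then for any learning rate 0 < η ≤ 1 and any initialization, the global iterates converge: lim_{T→∞} x^{(T,0)} = Σ_{i=1}^m [1 − (1−η)^{τ_i}] e_i / Σ_{i=1}^m [1 − (1−η)^{τ_i}]. -/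
open Filter Finset

/-- Gradient descent on `½‖· - a‖²` contracts the distance to `a` by `1 - η` at each step. -/
theorem gradientDescent_quadratic_sub {E : Type*} [AddCommGroup E] [Module ℝ E]
    {η : ℝ} {a : E} {z : ℕ → E} (hz : ∀ k, z (k + 1) = z k - η • (z k - a)) (k : ℕ) :
    z k - a = (1 - η) ^ k • (z 0 - a) := by
  induction k with
  | zero => simp
  | succ k ih =>
    have h : z (k + 1) - a = (1 - η) • (z k - a) := by
      rw [hz]
      module
    rw [h, ih, smul_smul, pow_succ']

/-- A sequence whose displacement from `c` is multiplied by `r` with `|r| < 1` at each step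
converges to `c`. -/
theorem tendsto_of_sub_eq_smul_sub {E : Type*} [NormedAddCommGroup E] [NormedSpace ℝ E]
    {r : ℝ} {c : E} {x : ℕ → E} (hr : |r| < 1) (hx : ∀ t, x (t + 1) - c = r • (x t - c)) :
    Tendsto x atTop (nhds c) := by
  have hpow : ∀ t, x t = r ^ t • (x 0 - c) + c := by
    intro t
    induction t with
    | zero => simp
    | succ t ih =>
      rw [← sub_eq_iff_eq_add, hx, sub_eq_iff_eq_add.mpr ih, smul_smul, pow_succ']
  have h := ((tendsto_pow_atTop_nhds_zero_of_abs_lt_one hr).smul_const (x 0 - c)).add_const c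
  rw [zero_smul, zero_add] at h
  exact h.congr fun t => (hpow t).symm

/-- **Objective inconsistency of FedAvg on quadratics.**
`m` clients have local objectives `F_i(x) = ½‖x − e_i‖²`.  In each round every client `i`
starts from the global model `x^{(t,0)}` and performs `τ_i ≥ 1` gradient-descent steps
with learning rate `η`; the server averages the cumulative local changes with equal
weights `1/m`.  For any `0 < η ≤ 1`, the global iterates converge to
`(∑ᵢ (1 − (1−η)^{τᵢ}))⁻¹ • ∑ᵢ (1 − (1−η)^{τᵢ}) • eᵢ`. -/
theorem fedavg_quadratic_convergence
    {d m : ℕ} (hm : 0 < m)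
    (e : Fin m → EuclideanSpace ℝ (Fin d))
    (τ : Fin m → ℕ) (hτ : ∀ i, 1 ≤ τ i)
    (η : ℝ) (hη0 : 0 < η) (hη1 : η ≤ 1)
    (x : ℕ → EuclideanSpace ℝ (Fin d))
    (y : Fin m → ℕ → ℕ → EuclideanSpace ℝ (Fin d))
    (hy0 : ∀ i t, y i t 0 = x t)
    (hyrec : ∀ i t k, y i t (k + 1) = y i t k - η • (y i t k - e i))
    (hserver : ∀ t, x (t + 1) = x t + (m : ℝ)⁻¹ • ∑ i, (y i t (τ i) - x t)) :
    Tendsto x atTop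
      (nhds ((∑ i, (1 - (1 - η) ^ τ i))⁻¹ • ∑ i, (1 - (1 - η) ^ τ i) • e i)) := by
  have hm' : (0 : ℝ) < m := by exact_mod_cast hm
  have : Nonempty (Fin m) := ⟨⟨0, hm⟩⟩
  set w : Fin m → ℝ := fun i => 1 - (1 - η) ^ τ i with hw
  have hw_pos : ∀ i, 0 < w i := fun i =>
    sub_pos.mpr (pow_lt_one₀ (by linarith) (by linarith) (Nat.one_le_iff_ne_zero.mp (hτ i)))
  have hw_le : ∀ i, w i ≤ 1 := fun i =>
    sub_le_self _ (pow_nonneg (by linarith) _)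
  have hW_pos : 0 < ∑ i, w i := Finset.sum_pos (fun i _ => hw_pos i) Finset.univ_nonempty
  have hW_le : ∑ i, w i ≤ m := by
    simpa using Finset.sum_le_sum fun i (_ : i ∈ Finset.univ) => hw_le i
  have hlocal : ∀ i t, y i t (τ i) - x t = w i • e i - w i • x t := by
    intro i t
    have h := gradientDescent_quadratic_sub (hyrec i t) (τ i)
    rw [hy0, sub_eq_iff_eq_add] at h
    rw [h]
    simp only [hw]
    module
  have hratio : |1 - (m : ℝ)⁻¹ * ∑ i, w i| < 1 := by
    have h_pos : 0 < (m : ℝ)⁻¹ * ∑ i, w i := by positivity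
    have h_le : (m : ℝ)⁻¹ * ∑ i, w i ≤ 1 := by
      rwa [inv_mul_le_iff₀ hm', mul_one]
    rw [abs_lt]
    constructor <;> linarith
  refine tendsto_of_sub_eq_smul_sub hratio fun t => ?_
  have hsum : ∑ i, w i • e i = (∑ i, w i) • ((∑ i, w i)⁻¹ • ∑ i, w i • e i) :=
    (smul_inv_smul₀ hW_pos.ne' _).symm
  rw [hserver, Finset.sum_congr rfl fun i _ => hlocal i t, Finset.sum_sub_distrib,
    ← Finset.sum_smul]
  generalize (∑ i, w i)⁻¹ • ∑ i, w i • e i = c at hsum ⊢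
  rw [hsum]
  module
end

section
/- Let τ_1, …, τ_m be positive integers and e_1, …, e_m ∈ ℝ^d. Then lim_{η→0⁺} ( Σ_{i=1}^m [1 − (1−η)^{τ_i}] e_i / Σ_{i=1}^m [1 − (1−η)^{τ_i}] ) = Σ_{i=1}^m τ_i e_i / Σ_{i=1}^m τ_i. Consequently, the limit point of FedAvg on the quadratic objectives F_i(x) = (1/2)‖x − e_i‖², in the small learning-rate limit, is the unique global minimizer of the surrogate objective F̃(x) = Σ_{i=1}^m τ_i F_i(x) / Σ_{i=1}^m τ_i rather than of F(x) = (1/m) Σ_{i=1}^m F_i(x). -/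
open Filter Finset

/-- Scaling all weights by a common nonzero factor does not change the weighted mean. -/
theorem inv_sum_mul_smul_sum_mul_smul {ι E : Type*} [Fintype ι] [AddCommGroup E] [Module ℝ E]
    {a : ℝ} (ha : a ≠ 0) (w : ι → ℝ) (e : ι → E) :
    (∑ i, a * w i)⁻¹ • ∑ i, (a * w i) • e i = (∑ i, w i)⁻¹ • ∑ i, w i • e i := by
  simp_rw [mul_smul]
  rw [← Finset.mul_sum, ← Finset.smul_sum, smul_smul, mul_inv_rev, inv_mul_cancel_right₀ ha]

/-- The Huygens–Steiner identity for weighted sums of squared distances. -/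
theorem sum_mul_norm_sub_sq_eq {ι E : Type*} [Fintype ι] [NormedAddCommGroup E]
    [InnerProductSpace ℝ E] (w : ι → ℝ) (e : ι → E) {c : E}
    (hc : ∑ i, w i • (c - e i) = 0) (y : E) :
    ∑ i, w i * ‖y - e i‖ ^ 2 = (∑ i, w i) * ‖y - c‖ ^ 2 + ∑ i, w i * ‖c - e i‖ ^ 2 := by
  have hcross : ∑ i, w i * inner ℝ (y - c) (c - e i) = 0 := by
    simp_rw [← real_inner_smul_right]
    rw [← inner_sum, hc, inner_zero_right]
  have hterm (i : ι) : w i * ‖y - e i‖ ^ 2 =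
      w i * ‖y - c‖ ^ 2 + 2 * (w i * inner ℝ (y - c) (c - e i)) + w i * ‖c - e i‖ ^ 2 := by
    rw [← sub_add_sub_cancel y c (e i), norm_add_sq_real]
    ring
  simp_rw [hterm]
  rw [Finset.sum_add_distrib, Finset.sum_add_distrib, ← Finset.mul_sum, hcross,
    ← Finset.sum_mul]
  ring

/-- **Small learning-rate limit of the FedAvg limit point.**
For positive integers `τ₁,…,τ_m` and vectors `e₁,…,e_m`, the FedAvg limit point
`(∑ᵢ (1 − (1−η)^{τᵢ}))⁻¹ • ∑ᵢ (1 − (1−η)^{τᵢ}) • eᵢ` converges, as `η → 0⁺`, to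
`(∑ᵢ τᵢ)⁻¹ • ∑ᵢ τᵢ • eᵢ`, which is the unique global minimizer of the surrogate
objective `F̃(x) = (∑ᵢ τᵢ)⁻¹ ∑ᵢ τᵢ Fᵢ(x)` with `Fᵢ(x) = ½‖x − eᵢ‖²`. -/
theorem fedavg_small_lr_limit_is_surrogate_minimizer
    {d m : ℕ} (hm : 0 < m)
    (e : Fin m → EuclideanSpace ℝ (Fin d))
    (τ : Fin m → ℕ) (hτ : ∀ i, 1 ≤ τ i) :
    Tendsto
      (fun η : ℝ => (∑ i, (1 - (1 - η) ^ τ i))⁻¹ • ∑ i, (1 - (1 - η) ^ τ i) • e i)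
      (nhdsWithin 0 (Set.Ioi 0))
      (nhds ((∑ i, (τ i : ℝ))⁻¹ • ∑ i, (τ i : ℝ) • e i))
    ∧ ∀ y : EuclideanSpace ℝ (Fin d),
        y ≠ (∑ i, (τ i : ℝ))⁻¹ • ∑ i, (τ i : ℝ) • e i →
        (∑ i, (τ i : ℝ))⁻¹ * ∑ i, (τ i : ℝ) * ((1 : ℝ) / 2 * ‖(∑ i, (τ i : ℝ))⁻¹ • ∑ i, (τ i : ℝ) • e i - e i‖ ^ 2)
          < (∑ i, (τ i : ℝ))⁻¹ * ∑ i, (τ i : ℝ) * ((1 : ℝ) / 2 * ‖y - e i‖ ^ 2) := by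
  have : Nonempty (Fin m) := ⟨⟨0, hm⟩⟩
  have hW : 0 < ∑ i, (τ i : ℝ) :=
    Finset.sum_pos (fun i _ => Nat.cast_pos.mpr (hτ i)) Finset.univ_nonempty
  constructor
  · let g : Fin m → ℝ → ℝ := fun i η => ∑ k ∈ range (τ i), (1 - η) ^ k
    have hg (i : Fin m) : Tendsto (g i) (nhdsWithin 0 (Set.Ioi 0)) (nhds (τ i : ℝ)) := by
      have hcont : Continuous (g i) := by fun_prop
      have h0 : g i 0 = τ i := by simp [g]
      exact h0 ▸ hcont.continuousWithinAt.tendsto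
    have hlim := ((tendsto_finsetSum univ fun i _ => hg i).inv₀ hW.ne').smul
      (tendsto_finsetSum univ fun i _ => (hg i).smul_const (e i))
    refine hlim.congr' ?_
    filter_upwards [self_mem_nhdsWithin] with η hη
    have hfactor (i : Fin m) : 1 - (1 - η) ^ τ i = η * g i η := by
      rw [← mul_neg_geom_sum, sub_sub_cancel]
    simp_rw [hfactor]
    exact (inv_sum_mul_smul_sum_mul_smul (ne_of_gt hη) (fun i => g i η) e).symm
  · intro y hy
    set c := (∑ i, (τ i : ℝ))⁻¹ • ∑ i, (τ i : ℝ) • e i with hc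
    have hbal : ∑ i, (τ i : ℝ) • (c - e i) = 0 := by
      simp_rw [smul_sub]
      rw [Finset.sum_sub_distrib, ← Finset.sum_smul, hc, smul_inv_smul₀ hW.ne', sub_self]
    have hdist : 0 < ‖y - c‖ := norm_pos_iff.mpr (sub_ne_zero.mpr hy)
    refine mul_lt_mul_of_pos_left ?_ (inv_pos.mpr hW)
    simp_rw [mul_left_comm _ (1 / 2 : ℝ)]
    rw [← Finset.mul_sum, ← Finset.mul_sum, sum_mul_norm_sub_sq_eq _ e hbal y]
    linarith [mul_pos hW (pow_pos hdist 2)]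
end

section
/- Let g_1, …, g_m ∈ ℝ^d, let w_1, …, w_m > 0 with Σ w_i = 1 and p_1, …, p_m ≥ 0 with Σ p_i = 1, and let β² ≥ 1, κ² ≥ 0 satisfy Σ_{i=1}^m w_i ‖g_i‖² ≤ β² ‖Σ_{i=1}^m w_i g_i‖² + κ². Then ‖Σ_{i=1}^m p_i g_i − Σ_{i=1}^m w_i g_i‖² ≤ χ²_{p‖w} [ (β² − 1) ‖Σ_{i=1}^m w_i g_i‖² + κ² ], where χ²_{p‖w} = Σ_{i=1}^m (p_i − w_i)²/w_i is the chi-square divergence between p and w. In particular, taking g_i = ∇F_i(x), the gradient of the true objective F = Σ p_i F_i and of the surrogate objective F̃ = Σ w_i F_i satisfy ‖∇F(x) − ∇F̃(x)‖² ≤ χ²_{p‖w}[(β² − 1)‖∇F̃(x)‖² + κ²] under the bounded dissimilarity assumption. -/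
open Finset

/-- A weighted Cauchy–Schwarz inequality for linear combinations of vectors. -/
theorem norm_sum_smul_sq_le_sum_sq_div_mul {ι E : Type*} [Fintype ι]
    [SeminormedAddCommGroup E] [NormedSpace ℝ E] (a w : ι → ℝ) (v : ι → E)
    (hw : ∀ i, 0 < w i) :
    ‖∑ i, a i • v i‖ ^ 2 ≤ (∑ i, a i ^ 2 / w i) * ∑ i, w i * ‖v i‖ ^ 2 := by
  have hnorm : ‖∑ i, a i • v i‖ ≤ ∑ i, |a i| * ‖v i‖ := by
    simpa [norm_smul] using norm_sum_le univ fun i => a i • v i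
  refine (pow_le_pow_left₀ (norm_nonneg _) hnorm 2).trans ?_
  refine sum_sq_le_sum_mul_sum_of_sq_le_mul univ
    (fun i _ => div_nonneg (sq_nonneg _) (hw i).le)
    (fun i _ => mul_nonneg (hw i).le (sq_nonneg _)) fun i _ => le_of_eq ?_
  have := (hw i).ne'
  rw [mul_pow, sq_abs]
  field_simp

/-- The weighted variance identity for vectors, with weights summing to one. -/
theorem sum_mul_norm_sub_weighted_sum_sq {ι E : Type*} [Fintype ι]
    [SeminormedAddCommGroup E] [InnerProductSpace ℝ E] (w : ι → ℝ) (g : ι → E)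
    (hws : ∑ i, w i = 1) :
    ∑ i, w i * ‖g i - ∑ j, w j • g j‖ ^ 2 =
      ∑ i, w i * ‖g i‖ ^ 2 - ‖∑ j, w j • g j‖ ^ 2 := by
  set c := ∑ j, w j • g j with hc
  have hinner : ∑ i, w i * inner ℝ (g i) c = ‖c‖ ^ 2 := by
    rw [← real_inner_self_eq_norm_sq]
    nth_rewrite 2 [hc]
    rw [sum_inner]
    simp [real_inner_smul_left]
  have hexpand : ∀ i, w i * ‖g i - c‖ ^ 2 =
      w i * ‖g i‖ ^ 2 - 2 * (w i * inner ℝ (g i) c) + w i * ‖c‖ ^ 2 := fun i => by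
    rw [norm_sub_sq_real]
    ring
  simp_rw [hexpand]
  rw [sum_add_distrib, sum_sub_distrib, ← mul_sum, ← sum_mul, hinner, hws]
  ring

/-- **Chi-square bound on the gradient mismatch.**
If `∑ᵢ wᵢ‖gᵢ‖² ≤ β²‖∑ᵢ wᵢ gᵢ‖² + κ²` (bounded dissimilarity), then
`‖∑ᵢ pᵢ gᵢ − ∑ᵢ wᵢ gᵢ‖² ≤ χ²_{p‖w} ((β² − 1)‖∑ᵢ wᵢ gᵢ‖² + κ²)` where
`χ²_{p‖w} = ∑ᵢ (pᵢ − wᵢ)²/wᵢ`.  In particular, taking `gᵢ = ∇Fᵢ(x)`, this bounds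
`‖∇F(x) − ∇F̃(x)‖²` for `F = ∑ pᵢFᵢ` and `F̃ = ∑ wᵢFᵢ`. -/
theorem chi_square_gradient_difference_bound
    {d m : ℕ} (g : Fin m → EuclideanSpace ℝ (Fin d))
    (w p : Fin m → ℝ)
    (hw : ∀ i, 0 < w i) (hws : ∑ i, w i = 1)
    (hp : ∀ i, 0 ≤ p i) (hps : ∑ i, p i = 1)
    (β2 κ2 : ℝ) (hβ2 : 1 ≤ β2) (hκ2 : 0 ≤ κ2)
    (hdis : ∑ i, w i * ‖g i‖ ^ 2 ≤ β2 * ‖∑ i, w i • g i‖ ^ 2 + κ2) :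
    ‖(∑ i, p i • g i) - ∑ i, w i • g i‖ ^ 2
      ≤ (∑ i, (p i - w i) ^ 2 / w i)
        * ((β2 - 1) * ‖∑ i, w i • g i‖ ^ 2 + κ2) := by
  set c := ∑ i, w i • g i with hc
  have hcentered : (∑ i, p i • g i) - c = ∑ i, (p i - w i) • (g i - c) := by
    simp only [smul_sub, sub_smul, sum_sub_distrib, ← sum_smul, hws, hps, ← hc]
    simp
  rw [hcentered]
  refine (norm_sum_smul_sq_le_sum_sq_div_mul _ w _ hw).trans ?_
  refine mul_le_mul_of_nonneg_left ?_
    (sum_nonneg fun i _ => div_nonneg (sq_nonneg _) (hw i).le)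
  rw [hc, sum_mul_norm_sub_weighted_sum_sq w g hws, ← hc]
  linarith
end

section
/- Let g_1, …, g_m ∈ ℝ^d, let w_1, …, w_m > 0 with Σ w_i = 1 and p_1, …, p_m ≥ 0 with Σ p_i = 1, and let β² ≥ 1, κ² ≥ 0 satisfy Σ_{i=1}^m w_i ‖g_i‖² ≤ β² ‖Σ_{i=1}^m w_i g_i‖² + κ². Then ‖Σ_{i=1}^m p_i g_i‖² ≤ 2[χ²_{p‖w}(β² − 1) + 1] ‖Σ_{i=1}^m w_i g_i‖² + 2 χ²_{p‖w} κ², where χ²_{p‖w} = Σ_{i=1}^m (p_i − w_i)²/w_i. -/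
open Finset

/-- **Weighted Cauchy–Schwarz inequality** for linear combinations of vectors. -/
theorem norm_sum_smul_sq_le_sum_sq_div_mul_sum {ι E : Type*} [SeminormedAddCommGroup E]
    [NormedSpace ℝ E] (s : Finset ι) (a w : ι → ℝ) (v : ι → E) (hw : ∀ i ∈ s, 0 < w i) :
    ‖∑ i ∈ s, a i • v i‖ ^ 2 ≤ (∑ i ∈ s, a i ^ 2 / w i) * ∑ i ∈ s, w i * ‖v i‖ ^ 2 := by
  calc ‖∑ i ∈ s, a i • v i‖ ^ 2 ≤ (∑ i ∈ s, ‖a i • v i‖) ^ 2 := by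
        gcongr
        exact norm_sum_le _ _
    _ ≤ _ := by
        refine Finset.sum_sq_le_sum_mul_sum_of_sq_le_mul s
          (fun i hi => div_nonneg (sq_nonneg _) (hw i hi).le)
          (fun i hi => mul_nonneg (hw i hi).le (sq_nonneg _)) fun i hi => le_of_eq ?_
        have := (hw i hi).ne'
        rw [norm_smul, mul_pow, Real.norm_eq_abs, sq_abs]
        field_simp

/-- The weighted variance of vectors around their weighted mean. -/
theorem sum_mul_norm_sub_sum_smul_sq {ι E : Type*} [NormedAddCommGroup E]
    [InnerProductSpace ℝ E] (s : Finset ι) (w : ι → ℝ) (v : ι → E) (hw : ∑ i ∈ s, w i = 1) :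
    ∑ i ∈ s, w i * ‖v i - ∑ j ∈ s, w j • v j‖ ^ 2
      = ∑ i ∈ s, w i * ‖v i‖ ^ 2 - ‖∑ i ∈ s, w i • v i‖ ^ 2 := by
  set G := ∑ j ∈ s, w j • v j with hG
  have hinner : ∑ i ∈ s, w i * inner ℝ (v i) G = ‖G‖ ^ 2 := by
    rw [← real_inner_self_eq_norm_sq]
    nth_rewrite 2 [hG]
    simp only [sum_inner, real_inner_smul_left]
  calc ∑ i ∈ s, w i * ‖v i - G‖ ^ 2
      = ∑ i ∈ s, (w i * ‖v i‖ ^ 2 - 2 * (w i * inner ℝ (v i) G) + w i * ‖G‖ ^ 2) :=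
        Finset.sum_congr rfl fun i _ => by rw [norm_sub_sq_real]; ring
    _ = _ := by
        rw [Finset.sum_add_distrib, Finset.sum_sub_distrib, ← Finset.mul_sum, hinner,
          ← Finset.sum_mul, hw]
        ring

/-- **Bounding the true gradient by the surrogate gradient.**
If `∑ᵢ wᵢ‖gᵢ‖² ≤ β²‖∑ᵢ wᵢ gᵢ‖² + κ²` (bounded dissimilarity), then
`‖∑ᵢ pᵢ gᵢ‖² ≤ 2(χ²_{p‖w}(β² − 1) + 1)‖∑ᵢ wᵢ gᵢ‖² + 2 χ²_{p‖w} κ²` where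
`χ²_{p‖w} = ∑ᵢ (pᵢ − wᵢ)²/wᵢ` is the chi-square divergence between `p` and `w`. -/
theorem chi_square_true_gradient_bound
    {d m : ℕ} (g : Fin m → EuclideanSpace ℝ (Fin d))
    (w p : Fin m → ℝ)
    (hw : ∀ i, 0 < w i) (hws : ∑ i, w i = 1)
    (hp : ∀ i, 0 ≤ p i) (hps : ∑ i, p i = 1)
    (β2 κ2 : ℝ) (hβ2 : 1 ≤ β2) (hκ2 : 0 ≤ κ2)
    (hdis : ∑ i, w i * ‖g i‖ ^ 2 ≤ β2 * ‖∑ i, w i • g i‖ ^ 2 + κ2) :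
    ‖∑ i, p i • g i‖ ^ 2
      ≤ 2 * ((∑ i, (p i - w i) ^ 2 / w i) * (β2 - 1) + 1) * ‖∑ i, w i • g i‖ ^ 2
        + 2 * (∑ i, (p i - w i) ^ 2 / w i) * κ2 := by
  set G := ∑ i, w i • g i with hG
  set χ := ∑ i, (p i - w i) ^ 2 / w i with hχ
  have hχ0 : 0 ≤ χ := Finset.sum_nonneg fun i _ => div_nonneg (sq_nonneg _) (hw i).le
  have hdiff : ∑ i, (p i - w i) • (g i - G) = ∑ i, p i • g i - G := by
    simp only [smul_sub, Finset.sum_sub_distrib, ← Finset.sum_smul, hps, hws, sub_self,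
      sub_zero, sub_smul, ← hG]
  have hcs : ‖∑ i, p i • g i - G‖ ^ 2 ≤ χ * ∑ i, w i * ‖g i - G‖ ^ 2 := by
    rw [← hdiff]
    exact norm_sum_smul_sq_le_sum_sq_div_mul_sum _ _ _ _ fun i _ => hw i
  have hvar : ∑ i, w i * ‖g i - G‖ ^ 2 ≤ (β2 - 1) * ‖G‖ ^ 2 + κ2 := by
    rw [hG, sum_mul_norm_sub_sum_smul_sq _ _ _ hws, ← hG]
    linarith
  have hpar : ‖∑ i, p i • g i‖ ^ 2 ≤ 2 * ‖G‖ ^ 2 + 2 * ‖∑ i, p i • g i - G‖ ^ 2 := by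
    have h : ‖∑ i, p i • g i‖ ≤ ‖G‖ + ‖∑ i, p i • g i - G‖ := norm_le_norm_add_norm_sub' _ _
    calc ‖∑ i, p i • g i‖ ^ 2 ≤ (‖G‖ + ‖∑ i, p i • g i - G‖) ^ 2 := by gcongr
      _ ≤ 2 * (‖G‖ ^ 2 + ‖∑ i, p i • g i - G‖ ^ 2) := add_sq_le
      _ = _ := by ring
  have hmul := mul_le_mul_of_nonneg_left hvar hχ0
  linarith
end
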